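/- Let (t_k) be a (one-sided or two-sided) strictly increasing sequence of real numbers with t_{k+1} − t_k ≥ δ for some δ > 0, and let μ_k ≥ 0 with Σ_k μ_k < ∞. Let (γ_n)_{n≥1} be a strictly increasing sequence of positive real numbers with γ_{n+1} − γ_n ≥ δ' for some δ' > 0, such that inf_{n,k} |γ_n − t_k| = d > 0 and Σ_{n≥1} 1/γ_n = ∞. Define f(x) = Σ_k μ_k/(x − t_k) for x ∉ {t_k} (the series converges absolutely at each γ_n). If Σ_{n≥1} |f(γ_n)| < ∞, then μ_k = 0 for all k. -/

import Mathlib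

/-- Weights of the partial fraction expansion of `∏ (t - g - s)/(t - g)`. -/
lemma weights_aux (s : ℝ) (hs : 0 < s) (G : Finset ℝ) :
    (∀ g ∈ G, ∀ h ∈ G, g < h → s ≤ h - g) →
    ∃ w : ℝ → ℝ, (∀ g ∈ G, 0 ≤ w g) ∧ ∑ g ∈ G, w g = G.card * s ∧
      ∀ t, (∀ g ∈ G, t ≠ g) → ∑ g ∈ G, w g / (t - g) = 1 - ∏ g ∈ G, (1 - s / (t - g)) := by
  induction G using Finset.induction_on_max with
  | empty => intro _; exact ⟨fun _ => 0, by simp⟩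
  | insert a G hmax ih =>
    intro hsep
    obtain ⟨w, hw0, hwsum, hw⟩ := ih (fun g hg h hh =>
      hsep g (Finset.mem_insert_of_mem hg) h (Finset.mem_insert_of_mem hh))
    have ha : a ∉ G := fun h => lt_irrefl _ (hmax a h)
    have hga : ∀ g ∈ G, g ≠ a := fun g hg => (hmax g hg).ne
    have hsa : ∀ g ∈ G, s ≤ a - g := fun g hg =>
      hsep g (Finset.mem_insert_of_mem hg) a (Finset.mem_insert_self _ _) (hmax g hg)
    refine ⟨fun g => if g = a then s * ∏ g ∈ G, (1 - s / (a - g)) else w g + w g * s / (a - g),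
      ?_, ?_, ?_⟩
    · intro g hg
      rcases Finset.mem_insert.1 hg with rfl | hg
      · simp only [if_true]
        refine mul_nonneg hs.le (Finset.prod_nonneg fun g hg => ?_)
        have := hsa g hg
        rw [sub_nonneg, div_le_one (by linarith)]
        exact this
      · simp only [hga g hg, if_false]
        have := hsa g hg
        have := hw0 g hg
        have : 0 < a - g := by linarith
        positivity
    · rw [Finset.sum_insert ha, Finset.card_insert_of_notMem ha]
      simp only [if_true]
      rw [Finset.sum_congr rfl (g := fun g => w g + s * (w g / (a - g)))
        (fun g hg => by simp only [hga g hg, if_false]; ring), Finset.sum_add_distrib,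
        ← Finset.mul_sum, hw a (fun g hg => (hga g hg).symm), hwsum]
      push_cast; ring
    · intro t ht
      have hta : t - a ≠ 0 := sub_ne_zero.2 (ht a (Finset.mem_insert_self _ _))
      have ht' : ∀ g ∈ G, t ≠ g := fun g hg => ht g (Finset.mem_insert_of_mem hg)
      rw [Finset.sum_insert ha, Finset.prod_insert ha]
      simp only [if_true]
      rw [Finset.sum_congr rfl (g := fun g => (1 - s / (t - a)) * (w g / (t - g))
          + s / (t - a) * (w g / (a - g)))
        (fun g hg => by
          have h1 : a - g ≠ 0 := sub_ne_zero.2 (hga g hg).symm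
          have h2 : t - g ≠ 0 := sub_ne_zero.2 (ht' g hg)
          simp only [hga g hg, if_false]
          field_simp
          ring), Finset.sum_add_distrib,
        ← Finset.mul_sum, ← Finset.mul_sum, hw a (fun g hg => (hga g hg).symm), hw t ht']
      ring

lemma weights_le (s : ℝ) (hs : 0 < s) (G : Finset ℝ)
    (hsep : ∀ g ∈ G, ∀ h ∈ G, g < h → s ≤ h - g) :
    ∃ w : ℝ → ℝ, (∀ g ∈ G, 0 ≤ w g) ∧ ∑ g ∈ G, w g = G.card * s ∧
      ∀ t, (∀ g ∈ G, s ≤ |g - t|) → ∑ g ∈ G, w g / (t - g) ≤ 1 := by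
  obtain ⟨w, h0, h1, h2⟩ := weights_aux s hs G hsep
  refine ⟨w, h0, h1, fun t ht => ?_⟩
  rw [h2 t (fun g hg h => by have := ht g hg; simp [h] at this; linarith)]
  have : 0 ≤ ∏ g ∈ G, (1 - s / (t - g)) := by
    refine Finset.prod_nonneg fun g hg => ?_
    have := ht g hg
    rcases le_total 0 (t - g) with h | h
    · rw [abs_of_nonpos (by linarith)] at this
      rw [sub_nonneg, div_le_one (by linarith)]
      linarith
    · have := div_nonpos_of_nonneg_of_nonpos hs.le h
      linarith
  linarith

/-- Upper bound for the dual potential. -/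
lemma potential_le (x s : ℝ) (hx : 0 < x) (G : Finset ℝ) (w : ℝ → ℝ)
    (hG : ∀ g ∈ G, x ≤ g ∧ g < 2 * x) (hw : ∀ g ∈ G, 0 ≤ w g) (t : ℝ)
    (h1 : ∑ g ∈ G, w g / (t - g) ≤ 1) :
    ∑ g ∈ G, w g / (t - g) ≤ (∑ g ∈ G, w g) / x * (-2 / 5 + 9 / 10 * (if x / 2 < |t| then 1 else 0))
      + ((if x / 2 < t then 1 else 0) - (if 4 * x < t then 1 else 0)) := by
  have hW : 0 ≤ (∑ g ∈ G, w g) / x := div_nonneg (Finset.sum_nonneg hw) hx.le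
  have key : ∀ c : ℝ, (∀ g ∈ G, 1 / (t - g) ≤ c / x) →
      ∑ g ∈ G, w g / (t - g) ≤ (∑ g ∈ G, w g) / x * c := by
    intro c hc
    have : (∑ g ∈ G, w g) / x * c = ∑ g ∈ G, w g * (c / x) := by
      rw [← Finset.sum_mul]; ring
    rw [this]
    refine Finset.sum_le_sum fun g hg => ?_
    rw [div_eq_mul_one_div]
    exact mul_le_mul_of_nonneg_left (hc g hg) (hw g hg)
  by_cases hA : x / 2 < |t|
  · by_cases hB : x / 2 < t
    · by_cases hC : 4 * x < t
      · have := key (1 / 2) (fun g hg => by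
          have := hG g hg
          rw [div_div, div_le_div_iff₀ (by linarith) (by linarith)]
          linarith)
        simp only [hA, hB, hC, if_true]
        linarith
      · simp only [hA, hB, hC, if_true, if_false]
        linarith
    · have ht : t < 0 := by
        by_contra h
        rw [abs_of_nonneg (by linarith)] at hA
        exact hB hA
      have hC : ¬ 4 * x < t := by linarith
      have := key 0 (fun g hg => by
        have := hG g hg
        rw [zero_div]
        exact div_nonpos_of_nonneg_of_nonpos zero_le_one (by linarith))
      simp only [hA, hB, hC, if_true, if_false]
      linarith
  · have h3 := abs_le.1 (not_lt.1 hA)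
    have hB : ¬ x / 2 < t := by linarith
    have hC : ¬ 4 * x < t := by linarith
    have := key (-2 / 5) (fun g hg => by
      have := hG g hg
      have e : 1 / (t - g) = - (1 / (g - t)) := by
        rw [← neg_sub g t, one_div_neg_eq_neg_one_div]
      have : (2 / 5) / x ≤ 1 / (g - t) := by
        rw [div_div, div_le_div_iff₀ (by linarith) (by linarith)]
        linarith
      rw [e, neg_div, neg_div]
      linarith)
    simp only [hA, hB, hC, if_false]
    linarith

/-- The estimate on one block. -/
lemma block_est {ι : Type*} (m t : ι → ℝ) (hm : ∀ i, 0 ≤ m i) (hsum : Summable m)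
    (s x : ℝ) (hs : 0 < s) (hx : 0 < x) (G : Finset ℝ)
    (hsep : ∀ g ∈ G, ∀ h ∈ G, g < h → s ≤ h - g)
    (hG : ∀ g ∈ G, x ≤ g ∧ g < 2 * x)
    (hdist : ∀ g ∈ G, ∀ i, s ≤ |g - t i|)
    (hM : 0 ≤ ∑' i, m i)
    (hO : ∑' i, m i * (if x / 2 < |t i| then 1 else 0) ≤ (∑' i, m i) / 9)
    (hf : ∀ g ∈ G, ∑' i, m i / (g - t i) ≤ (∑' i, m i) / 10 / g) :
    (∑' i, m i) / 5 * (G.card * s / x) ≤ ∑' i, m i * (if x / 2 < t i then 1 else 0)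
      - ∑' i, m i * (if 4 * x < t i then 1 else 0) := by
  obtain ⟨w, h0, h1, h2⟩ := weights_le s hs G hsep
  have hind : ∀ p : ι → Prop, ∀ [DecidablePred p], Summable fun i => m i * (if p i then (1:ℝ) else 0) := by
    intro p _
    refine Summable.of_nonneg_of_le (fun i => ?_) (fun i => ?_) hsum
    · have := hm i; positivity
    · have := hm i; split_ifs <;> simp [this]
  have hcau : ∀ g ∈ G, Summable fun i => m i / (g - t i) := by
    intro g hg
    refine Summable.of_norm_bounded (hsum.div_const s) (fun i => ?_)
    have := hdist g hg i
    rw [Real.norm_eq_abs, abs_div, abs_of_nonneg (hm i)]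
    exact div_le_div_of_nonneg_left (hm i) hs this
  set M := ∑' i, m i
  have hlow : ∑ g ∈ G, w g * ∑' i, m i / (g - t i) ≤ M / 10 / x * (G.card * s) := by
    rw [← h1, Finset.mul_sum]
    refine Finset.sum_le_sum fun g hg => ?_
    rw [mul_comm]
    refine mul_le_mul_of_nonneg_right ((hf g hg).trans ?_) (h0 g hg)
    exact div_le_div_of_nonneg_left (by positivity) hx (hG g hg).1
  have hs2 : ∀ g ∈ G, Summable fun i => w g * (m i / (g - t i)) := fun g hg => (hcau g hg).mul_left _
  have heq : ∑ g ∈ G, w g * ∑' i, m i / (g - t i) = ∑' i, ∑ g ∈ G, w g * (m i / (g - t i)) := by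
    rw [Summable.tsum_finsetSum hs2]
    exact Finset.sum_congr rfl fun g hg => (tsum_mul_left).symm
  set q := (G.card * s : ℝ) / x with hq
  have hpt : ∀ i, -(q * (-2 / 5) * m i + q * (9 / 10) * (m i * (if x / 2 < |t i| then 1 else 0))
      + (m i * (if x / 2 < t i then 1 else 0) - m i * (if 4 * x < t i then 1 else 0)))
      ≤ ∑ g ∈ G, w g * (m i / (g - t i)) := by
    intro i
    have hp := potential_le x s hx G w hG h0 (t i) (h2 (t i) (fun g hg => hdist g hg i))
    rw [h1] at hp
    have e : ∑ g ∈ G, w g * (m i / (g - t i)) = - (m i * ∑ g ∈ G, w g / (t i - g)) := by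
      rw [Finset.mul_sum, ← Finset.sum_neg_distrib]
      refine Finset.sum_congr rfl fun g hg => ?_
      rw [← neg_sub (t i) g, div_neg]; ring
    rw [e]
    have := mul_le_mul_of_nonneg_left hp (hm i)
    rw [← hq] at this
    linarith
  have S1 := hsum.mul_left (q * (-2 / 5))
  have S2 := (hind (fun i => x / 2 < |t i|)).mul_left (q * (9 / 10))
  have S3 := hind (fun i => x / 2 < t i)
  have S4 := hind (fun i => 4 * x < t i)
  have H := Summable.tsum_le_tsum hpt ((S1.add S2).add (S3.sub S4)).neg
    (summable_sum hs2)
  rw [tsum_neg, (S1.add S2).tsum_add (S3.sub S4), S1.tsum_add S2, S3.tsum_sub S4, tsum_mul_left,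
    tsum_mul_left, ← heq] at H
  have hq0 : 0 ≤ q := by positivity
  have := mul_le_mul_of_nonneg_left hO hq0
  have e2 : M / 10 / x * (G.card * s) = M / 10 * q := by rw [hq]; ring
  rw [e2] at hlow
  change M / 5 * q ≤ _
  have e3 : ∑' i, m i = M := rfl
  rw [e3] at H
  nlinarith

lemma telescope3 (a : ℕ → ℝ) (J : ℕ) :
    ∑ j ∈ Finset.range J, (a j - a (j + 3)) = a 0 + a 1 + a 2 - a J - a (J + 1) - a (J + 2) := by
  induction J with
  | zero => simp; ring
  | succ J ih => rw [Finset.sum_range_succ, ih]; ring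

lemma main_aux {ι : Type*} (m t : ι → ℝ) (hm : ∀ i, 0 ≤ m i) (hsum : Summable m)
    (γ : ℕ → ℝ) (hγpos : ∀ n, 0 < γ n) (s : ℝ) (hs : 0 < s)
    (hsep : ∀ k n, k < n → γ k + s ≤ γ n)
    (hdist : ∀ n i, s ≤ |γ n - t i|)
    (hf : Summable fun n : ℕ => |∑' i, m i / (γ n - t i)|)
    (hM : 0 < ∑' i, m i) : Summable fun n : ℕ => 1 / γ n := by
  classical
  set M := ∑' i, m i with hMdef
  -- outer masses are small
  have hO : ∃ J : ℕ, ∀ j ≥ J, ∑' i, m i * (if (2:ℝ) ^ j / 2 < |t i| then 1 else 0) ≤ M / 9 := by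
    have hT : Filter.Tendsto (fun j : ℕ => ∑' i, m i * (if (2:ℝ) ^ j / 2 < |t i| then (1:ℝ) else 0))
        Filter.atTop (nhds (∑' i : ι, (0:ℝ))) := by
      refine tendsto_tsum_of_dominated_convergence hsum (fun i => ?_) (Filter.Eventually.of_forall
        fun j i => ?_)
      · refine tendsto_const_nhds.congr' ?_
        have h2 : Filter.Tendsto (fun j : ℕ => (2:ℝ) ^ j) Filter.atTop Filter.atTop :=
          tendsto_pow_atTop_atTop_of_one_lt (by norm_num)
        filter_upwards [h2.eventually_ge_atTop (2 * |t i|)] with j hj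
        rw [if_neg (by linarith)]; simp
      · have := hm i
        rw [Real.norm_eq_abs, abs_mul, abs_of_nonneg this]
        split_ifs <;> simp [this]
    rw [tsum_zero] at hT
    obtain ⟨J, hJ⟩ := Filter.eventually_atTop.1 (hT.eventually (ge_mem_nhds (by positivity : 0 < M / 9)))
    exact ⟨J, hJ⟩
  obtain ⟨J, hJ⟩ := hO
  set a : ℕ → ℝ := fun j => ∑' i, m i * (if (2:ℝ) ^ j / 2 < t i then 1 else 0) with ha
  have ha0 : ∀ j, 0 ≤ a j := fun j => tsum_nonneg fun i => by have := hm i; positivity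
  have haM : ∀ j, a j ≤ M := fun j => by
    have hle : ∀ i, m i * (if (2:ℝ) ^ j / 2 < t i then 1 else 0) ≤ m i := fun i => by
      have := hm i; split_ifs <;> simp [this]
    refine Summable.tsum_le_tsum hle ?_ hsum
    exact Summable.of_nonneg_of_le (fun i => by have := hm i; positivity) hle hsum
  have hinj : Function.Injective γ := by
    intro k n h
    rcases lt_trichotomy k n with hkn | hkn | hkn
    · have := hsep k n hkn; linarith
    · exact hkn
    · have := hsep n k hkn; linarith
  -- the block estimate
  have hblock : ∀ j ≥ J, ∀ F : Finset ℕ, (∀ n ∈ F, (2:ℝ) ^ j ≤ γ n ∧ γ n < 2 * 2 ^ j) →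
      (∀ n ∈ F, |∑' i, m i / (γ n - t i)| ≤ M / 10 / γ n) →
      ∑ n ∈ F, 1 / γ n ≤ 5 / (M * s) * (a j - a (j + 3)) := by
    intro j hj F hF hFf
    have hx : (0:ℝ) < 2 ^ j := by positivity
    have hb := block_est m t hm hsum s (2 ^ j) hs hx (F.image γ)
      (by
        intro g hg h hh hgh
        obtain ⟨k, hk, rfl⟩ := Finset.mem_image.1 hg
        obtain ⟨n, hn, rfl⟩ := Finset.mem_image.1 hh
        rcases lt_trichotomy k n with hkn | hkn | hkn
        · have := hsep k n hkn; linarith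
        · subst hkn; exact absurd hgh (lt_irrefl _)
        · have := hsep n k hkn; linarith)
      (by
        intro g hg
        obtain ⟨k, hk, rfl⟩ := Finset.mem_image.1 hg
        exact hF k hk)
      (by
        intro g hg
        obtain ⟨k, hk, rfl⟩ := Finset.mem_image.1 hg
        exact hdist k)
      hM.le (hJ j hj)
      (by
        intro g hg
        obtain ⟨k, hk, rfl⟩ := Finset.mem_image.1 hg
        exact (le_abs_self _).trans (hFf k hk))
    rw [Finset.card_image_of_injective _ hinj] at hb
    have e1 : a (j + 3) = ∑' i, m i * (if 4 * (2:ℝ) ^ j < t i then 1 else 0) := by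
      simp only [ha]
      have : (2:ℝ) ^ (j + 3) / 2 = 4 * 2 ^ j := by rw [pow_add]; ring
      rw [this]
    rw [← e1] at hb
    change M / 5 * _ ≤ a j - a (j + 3) at hb
    have h1 : ∑ n ∈ F, 1 / γ n ≤ F.card * (1 / 2 ^ j) := by
      rw [← nsmul_eq_mul]
      refine Finset.sum_le_card_nsmul _ _ _ fun n hn => ?_
      exact one_div_le_one_div_of_le hx (hF n hn).1
    refine h1.trans ?_
    have h2 := mul_le_mul_of_nonneg_left hb (by positivity : 0 ≤ 5 / (M * s))
    refine le_trans (le_of_eq ?_) h2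
    field_simp
  -- good terms
  have hgood : Summable fun n : ℕ => |∑' i, m i / (γ n - t i)| * (10 / M) := hf.mul_right _
  -- large gamma
  obtain ⟨N, hN⟩ : ∃ N : ℕ, ∀ n ≥ N, (2:ℝ) ^ J ≤ γ n := by
    obtain ⟨N, hN⟩ := exists_nat_ge ((2:ℝ) ^ J / s)
    have hlin : ∀ n : ℕ, n * s ≤ γ n := by
      intro n
      induction n with
      | zero => simpa using (hγpos 0).le
      | succ n ih => have := hsep n (n + 1) (Nat.lt_succ_self n); push_cast; linarith
    refine ⟨N, fun n hn => ?_⟩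
    rw [div_le_iff₀ hs] at hN
    have : (N:ℝ) ≤ n := by exact_mod_cast hn
    nlinarith [hlin n]
  set A : ℕ → Prop := fun n => N ≤ n ∧ |∑' i, m i / (γ n - t i)| ≤ M / 10 / γ n with hA
  have hbad : Summable fun n : ℕ => if A n then 1 / γ n else 0 := by
    refine summable_of_sum_le (c := 5 / (M * s) * (3 * M)) (fun n => ?_) (fun F => ?_)
    · have := hγpos n
      simp only [Pi.zero_apply]
      positivity
    rw [← Finset.sum_filter]
    set F' := F.filter A with hF'
    have hmem : ∀ n ∈ F', A n := fun n hn => (Finset.mem_filter.1 hn).2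
    let lv : ℕ → ℕ := fun n => Nat.log 2 ⌊γ n⌋₊
    have hlv : ∀ n ∈ F', J ≤ lv n ∧ (2:ℝ) ^ (lv n) ≤ γ n ∧ γ n < 2 * 2 ^ (lv n) := by
      intro n hn
      have h1 := hN n (hmem n hn).1
      have h2 : 2 ^ J ≤ ⌊γ n⌋₊ := Nat.le_floor (by exact_mod_cast h1)
      have h3 : ⌊γ n⌋₊ ≠ 0 := by
        have : 0 < 2 ^ J := by positivity
        omega
      refine ⟨Nat.le_log_of_pow_le (by norm_num) h2, ?_, ?_⟩
      · have := Nat.pow_log_le_self 2 h3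
        have h4 : ((2 ^ lv n : ℕ) : ℝ) ≤ γ n :=
          le_trans (by exact_mod_cast this) (Nat.floor_le (hγpos n).le)
        exact_mod_cast h4
      · have h5 : ⌊γ n⌋₊ < 2 ^ (lv n + 1) := Nat.lt_pow_succ_log_self (by norm_num) _
        have := (Nat.floor_lt (hγpos n).le).1 h5
        push_cast at this
        rw [pow_succ] at this
        linarith
    obtain ⟨K, hK⟩ : ∃ K, ∀ n ∈ F', lv n < K :=
      ⟨F'.sup lv + 1, fun n hn => Nat.lt_succ_of_le (Finset.le_sup (f := lv) hn)⟩
    have hmaps : ∀ n ∈ F', lv n ∈ Finset.range K := fun n hn => Finset.mem_range.2 (hK n hn)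
    rw [← Finset.sum_fiberwise_of_maps_to hmaps]
    have hmono : ∀ j, a (j + 3) ≤ a j := by
      intro j
      have hle : ∀ j i, m i * (if (2:ℝ) ^ j / 2 < t i then 1 else 0) ≤ m i := fun j i => by
        have := hm i; split_ifs <;> simp [this]
      have hS : ∀ j, Summable fun i => m i * (if (2:ℝ) ^ j / 2 < t i then (1:ℝ) else 0) := fun j =>
        Summable.of_nonneg_of_le (fun i => by have := hm i; positivity) (hle j) hsum
      refine Summable.tsum_le_tsum (fun i => ?_) (hS _) (hS _)
      refine mul_le_mul_of_nonneg_left ?_ (hm i)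
      have h2 : (2:ℝ) ^ j ≤ 2 ^ (j + 3) := pow_le_pow_right₀ (by norm_num) (by omega)
      split_ifs
      · exact le_rfl
      · exfalso; linarith
      · norm_num
      · exact le_rfl
    calc ∑ j ∈ Finset.range K, ∑ n ∈ F' with lv n = j, 1 / γ n
        ≤ ∑ j ∈ Finset.range K, 5 / (M * s) * (a j - a (j + 3)) := by
          refine Finset.sum_le_sum fun j _ => ?_
          by_cases hj : J ≤ j
          · refine hblock j hj _ (fun n hn => ?_) (fun n hn => ?_)
            · obtain ⟨h1, rfl⟩ := Finset.mem_filter.1 hn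
              exact (hlv n h1).2
            · exact (hmem n (Finset.mem_filter.1 hn).1).2
          · have hemp : F'.filter (fun n => lv n = j) = ∅ :=
              Finset.filter_eq_empty_iff.2 (fun n hn h => hj (h ▸ (hlv n hn).1))
            rw [hemp, Finset.sum_empty]
            exact mul_nonneg (by positivity) (sub_nonneg.2 (hmono j))
      _ = 5 / (M * s) * (a 0 + a 1 + a 2 - a K - a (K + 1) - a (K + 2)) := by
          rw [← Finset.mul_sum, telescope3]
      _ ≤ 5 / (M * s) * (3 * M) := by
          refine mul_le_mul_of_nonneg_left ?_ (by positivity)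
          linarith [ha0 K, ha0 (K + 1), ha0 (K + 2), haM 0, haM 1, haM 2]
  refine (summable_nat_add_iff N).1 ?_
  refine Summable.of_nonneg_of_le (fun n => ?_) (fun n => ?_)
    ((summable_nat_add_iff N).2 (hgood.add hbad))
  · exact (one_div_pos.2 (hγpos _)).le
  · have hg := hγpos (n + N)
    by_cases h : A (n + N)
    · simp only [h, if_true]
      have : 0 ≤ |∑' i, m i / (γ (n + N) - t i)| * (10 / M) := by positivity
      linarith
    · simp only [h, if_false, add_zero]
      have h' : M / 10 / γ (n + N) < |∑' i, m i / (γ (n + N) - t i)| := by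
        by_contra hc
        exact h ⟨Nat.le_add_left _ _, not_lt.1 hc⟩
      have h2 := mul_le_mul_of_nonneg_right h'.le (by positivity : 0 ≤ 10 / M)
      refine le_trans (le_of_eq ?_) h2
      field_simp

/-- **Proposition (no ℓ¹ decay of Cauchy transforms along a divergent sequence).**
Let `T ⊆ ℝ` be a `δ`-separated set (the range of a one- or two-sided increasing
separated sequence), let `μ ≥ 0` be supported on `T` with `∑_{s ∈ T} μ(s) < ∞`, and let
`(γ_n)` be an increasing separated sequence of positive reals with
`dist({γ_n}, T) = d > 0` and `∑ 1/γ_n = ∞`.  If `f(x) = ∑_{s ∈ T} μ(s)/(x - s)`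
satisfies `∑_n |f(γ_n)| < ∞`, then `μ ≡ 0`. -/
theorem stmt9 (T : Set ℝ) (δ : ℝ) (hδ : 0 < δ)
    (hTsep : ∀ s ∈ T, ∀ u ∈ T, s ≠ u → δ ≤ |s - u|)
    (μ : ℝ → ℝ) (hμ0 : ∀ x, 0 ≤ μ x) (hμsupp : ∀ x ∉ T, μ x = 0)
    (hμsum : Summable fun s : T => μ s)
    (γ : ℕ → ℝ) (hγpos : ∀ n, 0 < γ n)
    (δ' : ℝ) (hδ' : 0 < δ') (hγsep : ∀ n, γ n + δ' ≤ γ (n + 1))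
    (d : ℝ) (hd : 0 < d) (hdist : ∀ n, ∀ s ∈ T, d ≤ |γ n - s|)
    (hγdiv : ¬ Summable fun n : ℕ => 1 / γ n)
    (hf : Summable fun n : ℕ => |∑' s : T, μ s / (γ n - s)|) :
    ∀ x, μ x = 0 := by
  by_contra hne
  push Not at hne
  obtain ⟨x, hx⟩ := hne
  have hxT : x ∈ T := by
    by_contra h
    exact hx (hμsupp x h)
  have hpos : 0 < ∑' s : T, μ s :=
    hμsum.tsum_pos (fun i => hμ0 i) ⟨x, hxT⟩ (lt_of_le_of_ne (hμ0 x) (Ne.symm hx))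
  have hstep : ∀ k n, k < n → γ k + δ' ≤ γ n := by
    intro k n hkn
    induction n, hkn using Nat.le_induction with
    | base => exact hγsep k
    | succ n _ ih => have := hγsep n; linarith
  refine hγdiv (main_aux (fun s : T => μ s) (fun s : T => (s : ℝ)) (fun i => hμ0 i) hμsum γ hγpos
    (min δ' d) (lt_min hδ' hd) (fun k n h => ?_) (fun n i => ?_) hf hpos)
  · have := hstep k n h
    have := min_le_left δ' d
    linarith
  · exact (min_le_right _ _).trans (hdist n i i.2)
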